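/- arXiv:2308.00311 — 4 statements merged into one kernel-verified Lean document; each statement's English description precedes it below -/
import Mathlib

section
/- Let ℓ' : ℝ^d × ℝ^p → ℝ be twice continuously differentiable, let a_1,…,a_{2p} ∈ ℝ^p, b ∈ ℝ^{2p}, c > 0, and let δ̂* : ℝ^d → ℝ^p be a differentiable map satisfying the barrier stationarity condition ∇_δ ℓ'(θ, δ̂*(θ)) + c ∑_{k=1}^{2p} a_k / (b_k − a_k^⊤ δ̂*(θ)) = 0 for all θ (with b_k − a_k^⊤ δ̂*(θ) > 0). Define γ_k(θ) = 1/(b_k − a_k^⊤ δ̂*(θ))² and C(θ) = c ∑_{k=1}^{2p} γ_k(θ) a_k a_k^⊤. If the matrix ∇²_δ ℓ'(θ, δ̂*(θ)) + C(θ) is invertible, then the Jacobian of δ̂* satisfies ∂δ̂*(θ)/∂θ = − ∇_θ∇_δ ℓ'(θ, δ̂*(θ)) · [∇²_δ ℓ'(θ, δ̂*(θ)) + C(θ)]^{−1}. -/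
open Finset

open scoped RealInnerProductSpace

/-- The partial gradient in the second variable of a `C²` function of two variables is jointly
differentiable. -/
theorem differentiable_partial_gradient {E F : Type*} [NormedAddCommGroup E] [NormedSpace ℝ E]
    [NormedAddCommGroup F] [InnerProductSpace ℝ F] [CompleteSpace F] {f : E → F → ℝ}
    (hf : ContDiff ℝ 2 (fun x : E × F => f x.1 x.2)) {g : E → F → F}
    (hg : ∀ x y, HasGradientAt (f x) (g x y) y) :
    Differentiable ℝ (fun x : E × F => g x.1 x.2) := by
  have hfd : Differentiable ℝ (fderiv ℝ (fun x : E × F => f x.1 x.2)) :=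
    (hf.fderiv_right (m := 1) (by norm_num)).differentiable (by norm_num)
  have key : (fun x : E × F => g x.1 x.2) = fun x => (InnerProductSpace.toDual ℝ F).symm
      ((fderiv ℝ (fun x : E × F => f x.1 x.2) x).comp (ContinuousLinearMap.inr ℝ E F)) := by
    funext x
    have h1 : HasFDerivAt (fun x : E × F => f x.1 x.2)
        (fderiv ℝ (fun x : E × F => f x.1 x.2) x) (x.1, x.2) :=
      (hf.differentiable (by norm_num) x).hasFDerivAt
    have h2 := h1.comp x.2 (hasFDerivAt_prodMk_right x.1 x.2)
    rw [← (hg x.1 x.2).hasFDerivAt.unique h2, LinearIsometryEquiv.symm_apply_apply]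
  rw [key]
  exact (InnerProductSpace.toDual ℝ F).symm.differentiable.comp
    (hfd.clm_comp (differentiable_const _))

/-- Chain rule along a curve `x ↦ (x, u x)` in terms of partial derivatives. -/
theorem HasFDerivAt.comp_graph {E F G : Type*} [NormedAddCommGroup E] [NormedSpace ℝ E]
    [NormedAddCommGroup F] [NormedSpace ℝ F] [NormedAddCommGroup G] [NormedSpace ℝ G]
    {g : E → F → G} {u : E → F} {x : E} {J : E →L[ℝ] F} {A : E →L[ℝ] G} {B : F →L[ℝ] G}
    (hg : DifferentiableAt ℝ (fun z : E × F => g z.1 z.2) (x, u x))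
    (hu : HasFDerivAt u J x) (hA : HasFDerivAt (fun t => g t (u x)) A x)
    (hB : HasFDerivAt (g x) B (u x)) :
    HasFDerivAt (fun t => g t (u t)) (A + B.comp J) x := by
  have h := hg.hasFDerivAt
  have hl : HasFDerivAt (fun t => g t (u x)) _ x :=
    HasFDerivAt.comp (g := fun z : E × F => g z.1 z.2) (f := fun t => (t, u x)) x h
      (hasFDerivAt_prodMk_left x (u x))
  have hr : HasFDerivAt (g x) _ (u x) :=
    HasFDerivAt.comp (g := fun z : E × F => g z.1 z.2) (u x) h (hasFDerivAt_prodMk_right x (u x))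
  have h1 := hA.unique hl
  have h2 := hB.unique hr
  refine (HasFDerivAt.comp (g := fun z : E × F => g z.1 z.2) x h
    ((hasFDerivAt_id x).prodMk hu)).congr_fderiv ?_
  ext v
  simp [h1, h2, ← map_add]

/-- Derivative of one term of the gradient of the log-barrier along a curve. -/
theorem HasFDerivAt.barrier_term {E F : Type*} [NormedAddCommGroup E] [NormedSpace ℝ E]
    [NormedAddCommGroup F] [InnerProductSpace ℝ F] {u : E → F} {x : E} {J : E →L[ℝ] F}
    (hu : HasFDerivAt u J x) (a : F) (b : ℝ) (h : b - ⟪a, u x⟫ ≠ 0) :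
    HasFDerivAt (fun t => (b - ⟪a, u t⟫)⁻¹ • a)
      ((((b - ⟪a, u x⟫) ^ 2)⁻¹ • (innerSL ℝ a).smulRight a).comp J) x := by
  have h1 : HasFDerivAt (fun t => b - ⟪a, u t⟫) (-((innerSL ℝ a).comp J)) x :=
    ((innerSL ℝ a).hasFDerivAt.comp x hu).const_sub b
  refine (((hasDerivAt_inv h).comp_hasFDerivAt x h1).smul_const a).congr_fderiv ?_
  ext v
  simp [smul_smul]

/-- Implicit differentiation of the log-barrier minimizer: if `δ̂*(θ)` satisfies
the barrier stationarity condition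
`∇_δ ℓ'(θ, δ̂*(θ)) + c ∑ₖ aₖ/(bₖ − aₖᵀδ̂*(θ)) = 0` and the matrix
`∇²_δ ℓ'(θ, δ̂*(θ)) + C(θ)` (with `C(θ) = c ∑ₖ γₖ aₖ aₖᵀ`,
`γₖ = 1/(bₖ − aₖᵀδ̂*(θ))²`) is invertible, then the Jacobian of `δ̂*` at `θ` is
`−[∇²_δ ℓ' + C(θ)]⁻¹ ∘ ∇_θ∇_δ ℓ'` (the linear-map form of
`∂δ̂*/∂θ = −∇_θ∇_δ ℓ' [∇²_δ ℓ' + C(θ)]⁻¹`). -/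
theorem stmt_5 (d p : ℕ)
    (ℓ' : EuclideanSpace ℝ (Fin d) → EuclideanSpace ℝ (Fin p) → ℝ)
    (hℓC2 : ContDiff ℝ 2 (fun x : EuclideanSpace ℝ (Fin d) × EuclideanSpace ℝ (Fin p) =>
      ℓ' x.1 x.2))
    (a : Fin (2 * p) → EuclideanSpace ℝ (Fin p)) (b : Fin (2 * p) → ℝ)
    (c : ℝ) (hc : 0 < c)
    (δs : EuclideanSpace ℝ (Fin d) → EuclideanSpace ℝ (Fin p))
    (hδs : Differentiable ℝ δs)
    -- `gradδ θ δ` is the gradient `∇_δ ℓ'(θ, δ)`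
    (gradδ : EuclideanSpace ℝ (Fin d) → EuclideanSpace ℝ (Fin p) → EuclideanSpace ℝ (Fin p))
    (hgradδ : ∀ θ δ, HasGradientAt (ℓ' θ) (gradδ θ δ) δ)
    -- the constraint is strictly feasible along `δ̂*` and stationarity holds
    (hfeas : ∀ θ k, 0 < b k - ⟪a k, δs θ⟫)
    (hstat : ∀ θ, gradδ θ (δs θ) + c • ∑ k, (b k - ⟪a k, δs θ⟫)⁻¹ • a k = 0)
    (θ : EuclideanSpace ℝ (Fin d))
    -- `J` is the Jacobian of `δ̂*` at `θ`
    (J : EuclideanSpace ℝ (Fin d) →L[ℝ] EuclideanSpace ℝ (Fin p))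
    (hJ : HasFDerivAt δs J θ)
    -- `H` is the Hessian `∇²_δ ℓ'(θ, δ̂*(θ))`
    (H : EuclideanSpace ℝ (Fin p) →L[ℝ] EuclideanSpace ℝ (Fin p))
    (hH : HasFDerivAt (fun δ => gradδ θ δ) H (δs θ))
    -- `Mθδ` is the mixed second derivative `∇_θ∇_δ ℓ'(θ, δ̂*(θ))`
    (Mθδ : EuclideanSpace ℝ (Fin d) →L[ℝ] EuclideanSpace ℝ (Fin p))
    (hM : HasFDerivAt (fun t => gradδ t (δs θ)) Mθδ θ)
    -- invertibility of `∇²_δ ℓ'(θ, δ̂*(θ)) + C(θ)`, where `C(θ) = c ∑ₖ γₖ aₖ aₖᵀ`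
    (E : EuclideanSpace ℝ (Fin p) ≃L[ℝ] EuclideanSpace ℝ (Fin p))
    (hE : (E : EuclideanSpace ℝ (Fin p) →L[ℝ] EuclideanSpace ℝ (Fin p)) =
      H + c • ∑ k, ((b k - ⟪a k, δs θ⟫) ^ 2)⁻¹ • ((innerSL ℝ (a k)).smulRight (a k))) :
    J = -((E.symm : EuclideanSpace ℝ (Fin p) →L[ℝ] EuclideanSpace ℝ (Fin p)).comp Mθδ) := by
  have hG := HasFDerivAt.comp_graph
    (differentiable_partial_gradient hℓC2 hgradδ (θ, δs θ)) hJ hM hH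
  have hB := (HasFDerivAt.fun_sum (u := Finset.univ) fun k _ =>
    hJ.barrier_term (a k) (b k) (hfeas θ k).ne').const_smul c
  have h0 : HasFDerivAt (fun t => gradδ t (δs t) + c • ∑ k, (b k - ⟪a k, δs t⟫)⁻¹ • a k)
      (0 : EuclideanSpace ℝ (Fin d) →L[ℝ] EuclideanSpace ℝ (Fin p)) θ := by
    simp only [hstat]
    exact hasFDerivAt_const _ _
  have heq := (hG.add hB).unique h0
  have hEJ : ∀ v, Mθδ v + E (J v) = 0 := fun v => by
    have hv := DFunLike.congr_fun heq v
    have hEv := DFunLike.congr_fun hE (J v)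
    simp only [ContinuousLinearEquiv.coe_coe] at hEv
    rw [hEv]
    simpa [add_assoc] using hv
  refine ContinuousLinearMap.ext fun v => E.injective ?_
  simpa using (neg_eq_of_add_eq_zero_right (hEJ v)).symm
end

section
/- Let h : ℝ^p → ℝ be differentiable, μ-strongly convex, and have L-Lipschitz gradient, with 0 < μ ≤ L. Then for the stepsize α = 2/(L + μ), the map y ↦ y − α∇h(y) is Lipschitz with constant (L − μ)/(L + μ); that is, ‖(y − α∇h(y)) − (y' − α∇h(y'))‖ ≤ ((L − μ)/(L + μ)) ‖y − y'‖ for all y, y' ∈ ℝ^p. -/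
open scoped RealInnerProductSpace

section GradientDescent

variable {E : Type*} [NormedAddCommGroup E] [InnerProductSpace ℝ E]

/-- The descent lemma: a function with `L`-Lipschitz gradient lies below its quadratic model. -/
theorem le_quadratic_of_lipschitz_gradient [CompleteSpace E] {h : E → ℝ} {g : E → E} {L : ℝ}
    (hgrad : ∀ y, HasGradientAt h (g y) y)
    (hlip : ∀ y y', ‖g y - g y'‖ ≤ L * ‖y - y'‖) (y v : E) :
    h (y + v) ≤ h y + ⟪g y, v⟫ + L / 2 * ‖v‖ ^ 2 := by
  have hline (t : ℝ) : HasDerivAt (fun s : ℝ => y + s • v) v t := by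
    simpa using ((hasDerivAt_id t).smul_const v).const_add y
  have hderiv (t : ℝ) :
      HasDerivAt (fun s : ℝ => h (y + s • v) - s * ⟪g y, v⟫ - L / 2 * ‖v‖ ^ 2 * s ^ 2)
        (⟪g (y + t • v), v⟫ - ⟪g y, v⟫ - L * ‖v‖ ^ 2 * t) t := by
    have h₁ : HasDerivAt (fun s : ℝ => h (y + s • v)) ⟪g (y + t • v), v⟫ t := by
      have hcomp := (hgrad (y + t • v)).hasFDerivAt.comp_hasDerivAt t (hline t)
      rw [InnerProductSpace.toDual_apply_apply] at hcomp
      exact hcomp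
    have h₂ : HasDerivAt (fun s : ℝ => s * ⟪g y, v⟫) ⟪g y, v⟫ t := by
      simpa using (hasDerivAt_id t).mul_const ⟪g y, v⟫
    have h₃ := (hasDerivAt_pow 2 t).const_mul (L / 2 * ‖v‖ ^ 2)
    refine ((h₁.sub h₂).sub h₃).congr_deriv ?_
    push_cast
    ring
  have hanti : AntitoneOn
      (fun s : ℝ => h (y + s • v) - s * ⟪g y, v⟫ - L / 2 * ‖v‖ ^ 2 * s ^ 2) (Set.Icc 0 1) := by
    refine antitoneOn_of_deriv_nonpos (convex_Icc 0 1)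
      (fun t _ => (hderiv t).continuousAt.continuousWithinAt)
      (fun t _ => (hderiv t).differentiableAt.differentiableWithinAt) fun t ht => ?_
    rw [interior_Icc] at ht
    have hinner := real_inner_le_norm (g (y + t • v) - g y) v
    have hnorm := hlip (y + t • v) y
    rw [add_sub_cancel_left, norm_smul, Real.norm_of_nonneg ht.1.le] at hnorm
    rw [inner_sub_left] at hinner
    rw [(hderiv t).deriv]
    nlinarith [mul_le_mul_of_nonneg_right hnorm (norm_nonneg v)]
  have := hanti (Set.left_mem_Icc.2 zero_le_one) (Set.right_mem_Icc.2 zero_le_one) zero_le_one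
  simp only [one_smul, zero_smul, add_zero] at this
  linarith

/-- First-order strong convexity implies strong monotonicity of the gradient. -/
theorem strongly_monotone_of_strongly_convex {h : E → ℝ} {g : E → E} {μ : ℝ}
    (hsconv : ∀ y y', h y + ⟪g y, y' - y⟫ + μ / 2 * ‖y' - y‖ ^ 2 ≤ h y') (y y' : E) :
    μ * ‖y - y'‖ ^ 2 ≤ ⟪g y - g y', y - y'⟫ := by
  have h₁ := hsconv y y'
  have h₂ := hsconv y' y
  rw [← neg_sub y y', inner_neg_right, norm_neg] at h₁
  rw [inner_sub_left]
  linarith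

/-- A lower quadratic bound and an upper quadratic bound, compared at the point minimizing their
difference. -/
theorem bregman_lower_bound {h : E → ℝ} {g : E → E} {μ L : ℝ} (hμL : μ < L)
    (hlower : ∀ y y', h y + ⟪g y, y' - y⟫ + μ / 2 * ‖y' - y‖ ^ 2 ≤ h y')
    (hupper : ∀ y v, h (y + v) ≤ h y + ⟪g y, v⟫ + L / 2 * ‖v‖ ^ 2) (y y' : E) :
    ‖g y - g y' - μ • (y - y')‖ ^ 2 ≤
      2 * (L - μ) * (h y' - h y + ⟪g y, y - y'⟫ - μ / 2 * ‖y - y'‖ ^ 2) := by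
  have hM : 0 < L - μ := sub_pos.2 hμL
  set d := y - y' with hd
  set w := g y - g y' - μ • d with hw
  set t := (L - μ)⁻¹
  have htM : t * (L - μ) = 1 := inv_mul_cancel₀ hM.ne'
  have h₁ := hlower y (y' + t • w)
  have h₂ := hupper y' (t • w)
  have hx : y' + t • w - y = t • w - d := by rw [hd]; abel
  rw [hx, norm_sub_sq_real, inner_sub_right, real_inner_smul_right, real_inner_smul_left,
    norm_smul, mul_pow, Real.norm_eq_abs, sq_abs] at h₁
  rw [real_inner_smul_right, norm_smul, mul_pow, Real.norm_eq_abs, sq_abs] at h₂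
  have hww : ‖w‖ ^ 2 = ⟪g y, w⟫ - ⟪g y', w⟫ - μ * ⟪w, d⟫ := by
    rw [← real_inner_self_eq_norm_sq]
    nth_rewrite 1 [hw]
    rw [inner_sub_left, inner_sub_left, real_inner_smul_left, real_inner_comm w d]
  have hbound : t / 2 * ‖w‖ ^ 2 ≤ h y' - h y + ⟪g y, d⟫ - μ / 2 * ‖d‖ ^ 2 := by
    have hq : t ^ 2 * (L - μ) = t := by rw [sq, mul_assoc, htM, mul_one]
    have hq' : t ^ 2 * (L - μ) * ‖w‖ ^ 2 = t * ‖w‖ ^ 2 := by rw [hq]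
    have hww' : t * ‖w‖ ^ 2 = t * (⟪g y, w⟫ - ⟪g y', w⟫ - μ * ⟪w, d⟫) := by rw [← hww]
    linarith
  calc ‖w‖ ^ 2 = 2 * (L - μ) * (t / 2 * ‖w‖ ^ 2) := by linear_combination -‖w‖ ^ 2 * htM
    _ ≤ _ := mul_le_mul_of_nonneg_left hbound (by positivity)

/-- The gradient inequality for strongly convex functions with Lipschitz gradient. -/
theorem inner_gradient_lower_bound [CompleteSpace E] {h : E → ℝ} {g : E → E} {μ L : ℝ}
    (hμ : 0 < μ) (hμL : μ ≤ L)
    (hgrad : ∀ y, HasGradientAt h (g y) y)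
    (hsconv : ∀ y y', h y + ⟪g y, y' - y⟫ + μ / 2 * ‖y' - y‖ ^ 2 ≤ h y')
    (hlip : ∀ y y', ‖g y - g y'‖ ≤ L * ‖y - y'‖) (y y' : E) :
    μ * L * ‖y - y'‖ ^ 2 + ‖g y - g y'‖ ^ 2 ≤ (L + μ) * ⟪g y - g y', y - y'⟫ := by
  rcases hμL.eq_or_lt with rfl | hlt
  · have hmono := strongly_monotone_of_strongly_convex hsconv y y'
    have hsq := pow_le_pow_left₀ (norm_nonneg _) (hlip y y') 2
    nlinarith [mul_le_mul_of_nonneg_left hmono hμ.le]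
  · have hupper := le_quadratic_of_lipschitz_gradient hgrad hlip
    have h₁ := bregman_lower_bound hlt hsconv hupper y y'
    have h₂ := bregman_lower_bound hlt hsconv hupper y' y
    have hneg : g y' - g y - μ • (y' - y) = -(g y - g y' - μ • (y - y')) := by
      rw [smul_sub, smul_sub]
      abel
    rw [hneg, norm_neg, ← neg_sub y y', inner_neg_right, norm_neg] at h₂
    have hexp : ‖g y - g y' - μ • (y - y')‖ ^ 2 =
        ‖g y - g y'‖ ^ 2 - 2 * (μ * ⟪g y - g y', y - y'⟫) + μ ^ 2 * ‖y - y'‖ ^ 2 := by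
      rw [norm_sub_sq_real, real_inner_smul_right, norm_smul, mul_pow, Real.norm_eq_abs, sq_abs]
    rw [hexp] at h₁ h₂
    have hin : ⟪g y - g y', y - y'⟫ = ⟪g y, y - y'⟫ - ⟪g y', y - y'⟫ := inner_sub_left _ _ _
    rw [hin] at h₁ h₂ ⊢
    linarith

end GradientDescent

/-- For a differentiable, `μ`-strongly convex function `h` with `L`-Lipschitz
gradient (`0 < μ ≤ L`), the gradient-descent map `y ↦ y − α ∇h(y)` with stepsize
`α = 2/(L + μ)` is a contraction with constant `(L − μ)/(L + μ)`. -/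
theorem stmt_7 (p : ℕ) (h : EuclideanSpace ℝ (Fin p) → ℝ)
    (g : EuclideanSpace ℝ (Fin p) → EuclideanSpace ℝ (Fin p))
    (μ L : ℝ) (hμ : 0 < μ) (hμL : μ ≤ L)
    (hgrad : ∀ y, HasGradientAt h (g y) y)
    (hsconv : ∀ y y', h y + ⟪g y, y' - y⟫ + μ / 2 * ‖y' - y‖ ^ 2 ≤ h y')
    (hlip : ∀ y y', ‖g y - g y'‖ ≤ L * ‖y - y'‖) :
    ∀ y y', ‖(y - (2 / (L + μ)) • g y) - (y' - (2 / (L + μ)) • g y')‖ ≤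
      (L - μ) / (L + μ) * ‖y - y'‖ := by
  intro y y'
  have hs : 0 < L + μ := by linarith
  have hkey := inner_gradient_lower_bound hμ hμL hgrad hsconv hlip y y'
  have hdiff : (y - (2 / (L + μ)) • g y) - (y' - (2 / (L + μ)) • g y') =
      (y - y') - (2 / (L + μ)) • (g y - g y') := by
    rw [smul_sub]
    abel
  have hnonneg : 0 ≤ (L - μ) / (L + μ) := div_nonneg (sub_nonneg.2 hμL) hs.le
  rw [hdiff]
  refine (sq_le_sq₀ (norm_nonneg _) (mul_nonneg hnonneg (norm_nonneg _))).1 ?_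
  rw [norm_sub_sq_real, real_inner_smul_right, norm_smul, mul_pow, Real.norm_eq_abs, sq_abs,
    real_inner_comm, ← sub_nonneg]
  have hrw : ((L - μ) / (L + μ) * ‖y - y'‖) ^ 2 - (‖y - y'‖ ^ 2 -
        2 * (2 / (L + μ) * ⟪g y - g y', y - y'⟫) + (2 / (L + μ)) ^ 2 * ‖g y - g y'‖ ^ 2) =
      4 / (L + μ) ^ 2 * ((L + μ) * ⟪g y - g y', y - y'⟫ -
        (μ * L * ‖y - y'‖ ^ 2 + ‖g y - g y'‖ ^ 2)) := by
    field_simp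
    ring
  rw [hrw]
  exact mul_nonneg (by positivity) (sub_nonneg.2 hkey)
end

section
/- Let h : ℝ^d × ℝ^p → ℝ be differentiable in δ such that for every θ the function h(θ, ·) is μ-strongly convex, and such that θ ↦ ∇_δ h(θ, δ) is L-Lipschitz uniformly in δ. Let V ⊆ ℝ^p be a nonempty closed convex set and δ*(θ) the unique minimizer of h(θ, ·) over V. Then the map θ ↦ δ*(θ) is (L/μ)-Lipschitz: ‖δ*(θ) − δ*(θ')‖ ≤ (L/μ)‖θ − θ'‖ for all θ, θ'. -/
open scoped RealInnerProductSpace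

/-- First-order optimality: if `x` minimizes `f` over a convex set, then the gradient of `f` at `x`
has nonnegative inner product with every feasible direction. -/
theorem HasGradientAt.inner_sub_nonneg_of_isMinOn {E : Type*} [NormedAddCommGroup E]
    [InnerProductSpace ℝ E] [CompleteSpace E] {f : E → ℝ} {f' x y : E} {s : Set E}
    (hf : HasGradientAt f f' x) (hs : Convex ℝ s) (hx : x ∈ s) (hy : y ∈ s)
    (hmin : IsMinOn f s x) : 0 ≤ ⟪f', y - x⟫ := by
  simpa using hmin.localize.hasFDerivWithinAt_nonneg hf.hasFDerivAt.hasFDerivWithinAt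
    (sub_mem_posTangentConeAt_of_segment_subset (hs.segment_subset hx hy))

/-- Lipschitzness of the argmin map: if `h(θ, ·)` is `μ`-strongly convex and
`θ ↦ ∇_δ h(θ, δ)` is `L`-Lipschitz uniformly in `δ`, then the minimizer
`δ*(θ)` of `h(θ, ·)` over the nonempty closed convex set `V` is `(L/μ)`-Lipschitz
in `θ`. -/
theorem stmt_10 (d p : ℕ) (V : Set (EuclideanSpace ℝ (Fin p)))
    (hVne : V.Nonempty) (hVcl : IsClosed V) (hVcv : Convex ℝ V)
    (h : EuclideanSpace ℝ (Fin d) → EuclideanSpace ℝ (Fin p) → ℝ)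
    (g : EuclideanSpace ℝ (Fin d) → EuclideanSpace ℝ (Fin p) → EuclideanSpace ℝ (Fin p))
    (μ L : ℝ) (hμ : 0 < μ)
    (hgrad : ∀ θ δ, HasGradientAt (h θ) (g θ δ) δ)
    (hsconv : ∀ θ δ δ', h θ δ + ⟪g θ δ, δ' - δ⟫ + μ / 2 * ‖δ' - δ‖ ^ 2 ≤ h θ δ')
    (hlipθ : ∀ θ θ' δ, ‖g θ δ - g θ' δ‖ ≤ L * ‖θ - θ'‖)
    -- `δ*(θ)` is the unique minimizer of `h(θ, ·)` over `V`
    (δstar : EuclideanSpace ℝ (Fin d) → EuclideanSpace ℝ (Fin p))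
    (hmin : ∀ θ, δstar θ ∈ V ∧ ∀ δ ∈ V, h θ (δstar θ) ≤ h θ δ)
    (huniq : ∀ θ, ∀ z ∈ V, (∀ δ ∈ V, h θ z ≤ h θ δ) → z = δstar θ) :
    ∀ θ θ', ‖δstar θ - δstar θ'‖ ≤ L / μ * ‖θ - θ'‖ := by
  intro θ θ'
  set a := δstar θ
  set b := δstar θ'
  have ha : 0 ≤ ⟪g θ a, b - a⟫ :=
    (hgrad θ a).inner_sub_nonneg_of_isMinOn hVcv (hmin θ).1 (hmin θ').1 (hmin θ).2
  have hb : 0 ≤ ⟪g θ' b, a - b⟫ :=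
    (hgrad θ' b).inner_sub_nonneg_of_isMinOn hVcv (hmin θ').1 (hmin θ).1 (hmin θ').2
  have hab := hsconv θ a b
  have hba := hsconv θ b a
  rw [norm_sub_rev b a] at hab
  have hinner : ⟪g θ' b - g θ b, a - b⟫ ≤ L * ‖θ - θ'‖ * ‖a - b‖ := by
    refine (real_inner_le_norm _ _).trans ?_
    rw [norm_sub_rev (g θ' b)]
    exact mul_le_mul_of_nonneg_right (hlipθ θ θ' b) (norm_nonneg _)
  rw [inner_sub_left] at hinner
  have hsq : μ * ‖a - b‖ * ‖a - b‖ ≤ L * ‖θ - θ'‖ * ‖a - b‖ := by linarith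
  rw [div_mul_eq_mul_div, le_div_iff₀ hμ, mul_comm]
  rcases (norm_nonneg (a - b)).eq_or_lt with h0 | hpos
  · rw [← h0, mul_zero]
    exact (norm_nonneg _).trans (hlipθ θ θ' b)
  · exact le_of_mul_le_mul_right hsq hpos
end

section
/- (Lemma D.2) Let g_1, …, g_M : ℝ^d × ℝ^p → ℝ^m each be C-Lipschitz, and for each i let θ ↦ δ^K_i(θ) ∈ ℝ^p be κ-Lipschitz. Write ḡ(θ) = (1/M) ∑_{i=1}^M g_i(θ, δ^K_i(θ)) and assume the variance bound (1/M) ∑_{i=1}^M ‖g_i(θ, δ^K_i(θ)) − ḡ(θ)‖² ≤ σ_g² for all θ. Fix θ_{t−1}, θ_t ∈ ℝ^d, u_t ∈ ℝ^m, and η_t ∈ (0, 1]. Let B = (i_1, …, i_{|B|}) be indices drawn independently and uniformly at random from {1, …, M}, and set u_{t+1} = (1 − η_t) u_t + (η_t/|B|) ∑_{j=1}^{|B|} g_{i_j}(θ_t, δ^K_{i_j}(θ_t)). Then E_B ‖u_{t+1} − ḡ(θ_t)‖² ≤ (1 − η_t) ‖u_t − ḡ(θ_{t−1})‖² + (2 η_t²/|B|)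 σ_g² + (C²/η_t)(1 + κ²) ‖θ_t − θ_{t−1}‖². -/
open Finset

section

variable {E : Type*} [NormedAddCommGroup E] [InnerProductSpace ℝ E]

/-- Translating a centred family shifts its mean square by the squared norm of the translation. -/
theorem sum_norm_add_sq_of_sum_eq_zero {ι : Type*} [Fintype ι] (X : ι → E) (hX : ∑ i, X i = 0)
    (c : E) : ∑ i, ‖c + X i‖ ^ 2 = Fintype.card ι * ‖c‖ ^ 2 + ∑ i, ‖X i‖ ^ 2 := by
  simp_rw [norm_add_sq_real, sum_add_distrib, ← mul_sum, ← inner_sum, hX]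
  simp

/-- Second moment of a shifted sum of `n` independent uniform draws from a centred family. -/
theorem sum_norm_add_sum_sq_of_sum_eq_zero {ι : Type*} [Fintype ι] (X : ι → E)
    (hX : ∑ i, X i = 0) (v : ℝ) (hv : ∑ i, ‖X i‖ ^ 2 = Fintype.card ι * v) (n : ℕ) (c : E) :
    ∑ B : Fin n → ι, ‖c + ∑ j, X (B j)‖ ^ 2 =
      (Fintype.card ι : ℝ) ^ n * (‖c‖ ^ 2 + n * v) := by
  induction n generalizing c with
  | zero => simp
  | succ n ih =>
    rw [← (Fin.consEquiv fun _ : Fin (n + 1) => ι).sum_comp, Fintype.sum_prod_type]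
    simp only [Fin.consEquiv_apply, Fin.sum_univ_succ, Fin.cons_zero, Fin.cons_succ, ← add_assoc,
      ih, ← mul_sum, sum_add_distrib, sum_norm_add_sq_of_sum_eq_zero X hX, hv, sum_const,
      card_univ, nsmul_eq_mul]
    push_cast
    ring

/-- The squared norm of an average is bounded by a common bound on the squared norms. -/
theorem norm_average_sq_le {M : ℕ} (hM : 0 < M) (w : Fin M → E) (L : ℝ)
    (hw : ∀ i, ‖w i‖ ^ 2 ≤ L) : ‖(1 / (M : ℝ)) • ∑ i, w i‖ ^ 2 ≤ L := by
  have hM' : (0 : ℝ) < M := Nat.cast_pos.mpr hM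
  have h : ‖∑ i, w i‖ ^ 2 ≤ M * (M * L) := by
    calc ‖∑ i, w i‖ ^ 2 ≤ (∑ i, ‖w i‖) ^ 2 := by
          gcongr
          exact norm_sum_le _ _
      _ ≤ M * ∑ i, ‖w i‖ ^ 2 := by
          simpa using sq_sum_le_card_mul_sum_sq (s := univ) (f := fun i => ‖w i‖)
      _ ≤ M * ∑ _i : Fin M, L := by
          gcongr with i
          exact hw i
      _ = M * (M * L) := by simp
  rw [norm_smul, mul_pow, Real.norm_of_nonneg (by positivity), div_pow, one_pow,
    one_div_mul_eq_div, div_le_iff₀ (by positivity)]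
  linarith

/-- Young's inequality with weights `1 - η` and `η`. -/
theorem sq_norm_one_sub_smul_add_le (a b : E) {η : ℝ} (hη0 : 0 < η) (hη1 : η ≤ 1) :
    ‖(1 - η) • (a + b)‖ ^ 2 ≤ (1 - η) * ‖a‖ ^ 2 + ‖b‖ ^ 2 / η := by
  have h1 : 0 ≤ 1 - η := by linarith
  have h2 : ‖(1 - η) • (a + b)‖ ≤ (1 - η) * ‖a‖ + η * (‖b‖ / η) := by
    rw [norm_smul, Real.norm_of_nonneg h1, mul_div_cancel₀ _ hη0.ne']
    nlinarith [norm_add_le a b, norm_nonneg b]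
  calc ‖(1 - η) • (a + b)‖ ^ 2 ≤ ((1 - η) * ‖a‖ + η * (‖b‖ / η)) ^ 2 := by gcongr
    _ ≤ (1 - η) * ‖a‖ ^ 2 + η * (‖b‖ / η) ^ 2 := by
        nlinarith [mul_nonneg (mul_nonneg h1 hη0.le) (sq_nonneg (‖a‖ - ‖b‖ / η))]
    _ = (1 - η) * ‖a‖ ^ 2 + ‖b‖ ^ 2 / η := by field_simp

end

/-- Lemma D.2: tracking error of the running average `u_{t+1}` of the composed
function values. The expectation `E_B` over the i.i.d. uniform minibatch
`B = (i_1, …, i_n)` is written as the average over all `B : Fin n → Fin M`. -/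
theorem stmt_13 (d p m M n : ℕ) (hM : 0 < M) (hn : 0 < n)
    (g : Fin M → EuclideanSpace ℝ (Fin d) → EuclideanSpace ℝ (Fin p) →
      EuclideanSpace ℝ (Fin m))
    (δK : Fin M → EuclideanSpace ℝ (Fin d) → EuclideanSpace ℝ (Fin p))
    (C κ σg : ℝ)
    -- each `g_i` is `C`-Lipschitz in `(θ, δ)` jointly
    (hglip : ∀ i θ δ θ' δ', ‖g i θ δ - g i θ' δ'‖ ^ 2 ≤
      C ^ 2 * (‖θ - θ'‖ ^ 2 + ‖δ - δ'‖ ^ 2))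
    -- each `θ ↦ δ^K_i(θ)` is `κ`-Lipschitz
    (hδlip : ∀ i θ θ', ‖δK i θ - δK i θ'‖ ≤ κ * ‖θ - θ'‖)
    -- `ḡ(θ) = (1/M) ∑ᵢ g_i(θ, δ^K_i(θ))`
    (gbar : EuclideanSpace ℝ (Fin d) → EuclideanSpace ℝ (Fin m))
    (hgbar : ∀ θ, gbar θ = (1 / (M : ℝ)) • ∑ i, g i θ (δK i θ))
    -- bounded variance
    (hvar : ∀ θ, (1 / (M : ℝ)) * ∑ i, ‖g i θ (δK i θ) - gbar θ‖ ^ 2 ≤ σg ^ 2)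
    (θprev θt : EuclideanSpace ℝ (Fin d)) (ut : EuclideanSpace ℝ (Fin m))
    (ηt : ℝ) (hη0 : 0 < ηt) (hη1 : ηt ≤ 1) :
    (1 / (M : ℝ) ^ n) * ∑ B : Fin n → Fin M,
        ‖((1 - ηt) • ut + (ηt / (n : ℝ)) • ∑ j, g (B j) θt (δK (B j) θt)) - gbar θt‖ ^ 2 ≤
      (1 - ηt) * ‖ut - gbar θprev‖ ^ 2 + 2 * ηt ^ 2 / (n : ℝ) * σg ^ 2
        + C ^ 2 / ηt * (1 + κ ^ 2) * ‖θt - θprev‖ ^ 2 := by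
  have hM' : (0 : ℝ) < M := Nat.cast_pos.mpr hM
  have hn' : (0 : ℝ) < n := Nat.cast_pos.mpr hn
  set X : Fin M → EuclideanSpace ℝ (Fin m) := fun i => g i θt (δK i θt) - gbar θt with hXdef
  have hX : ∑ i, X i = 0 := by
    simp only [hXdef, sum_sub_distrib, sum_const, card_univ, Fintype.card_fin]
    rw [hgbar θt, ← Nat.cast_smul_eq_nsmul ℝ, smul_smul, mul_one_div_cancel hM'.ne', one_smul,
      sub_self]
  set v : ℝ := (1 / (M : ℝ)) * ∑ i, ‖X i‖ ^ 2 with hvdef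
  have hv : v ≤ σg ^ 2 := hvar θt
  set c := (1 - ηt) • ((ut - gbar θprev) + (gbar θprev - gbar θt)) with hc
  have hsplit : ∀ B : Fin n → Fin M,
      ((1 - ηt) • ut + (ηt / (n : ℝ)) • ∑ j, g (B j) θt (δK (B j) θt)) - gbar θt =
        c + ∑ j, (ηt / (n : ℝ)) • X (B j) := by
    intro B
    have h : (ηt / (n : ℝ)) • ((n : ℝ) • gbar θt) = ηt • gbar θt := by
      rw [smul_smul, div_mul_cancel₀ _ hn'.ne']
    simp only [hXdef, ← smul_sum, sum_sub_distrib, sum_const, card_univ, Fintype.card_fin]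
    rw [← Nat.cast_smul_eq_nsmul ℝ, smul_sub, h, hc]
    module
  have hmoment := sum_norm_add_sum_sq_of_sum_eq_zero (fun i => (ηt / (n : ℝ)) • X i)
    (by rw [← smul_sum, hX, smul_zero]) ((ηt / n) ^ 2 * v)
    (by
      simp only [norm_smul, mul_pow, Real.norm_eq_abs, sq_abs, ← mul_sum, hvdef,
        Fintype.card_fin]
      field_simp) n c
  have hdrift : ‖gbar θprev - gbar θt‖ ^ 2 ≤ C ^ 2 * (1 + κ ^ 2) * ‖θt - θprev‖ ^ 2 := by
    rw [hgbar, hgbar, ← smul_sub, ← sum_sub_distrib]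
    refine norm_average_sq_le hM _ _ fun i => (hglip i _ _ _ _).trans ?_
    have h := pow_le_pow_left₀ (norm_nonneg _) (hδlip i θprev θt) 2
    rw [mul_pow] at h
    rw [norm_sub_rev θt θprev, mul_assoc]
    gcongr
    linarith
  have hyoung := sq_norm_one_sub_smul_add_le (ut - gbar θprev) (gbar θprev - gbar θt) hη0 hη1
  have hdrift' := div_le_div_of_nonneg_right hdrift hη0.le
  have hnoise : n * ((ηt / n) ^ 2 * v) ≤ 2 * ηt ^ 2 / n * σg ^ 2 := by
    calc n * ((ηt / n) ^ 2 * v) = ηt ^ 2 / n * v := by field_simp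
      _ ≤ ηt ^ 2 / n * σg ^ 2 := by gcongr
      _ ≤ 2 * (ηt ^ 2 / n * σg ^ 2) := le_mul_of_one_le_left (by positivity) one_le_two
      _ = 2 * ηt ^ 2 / n * σg ^ 2 := by ring
  simp_rw [hsplit]
  rw [hmoment, Fintype.card_fin, ← mul_assoc, one_div_mul_cancel (by positivity), one_mul]
  calc ‖c‖ ^ 2 + n * ((ηt / n) ^ 2 * v)
      ≤ (1 - ηt) * ‖ut - gbar θprev‖ ^ 2 + C ^ 2 * (1 + κ ^ 2) * ‖θt - θprev‖ ^ 2 / ηt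
        + 2 * ηt ^ 2 / n * σg ^ 2 := by linarith
    _ = _ := by ring
end
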